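/- arXiv:2605.03453 — 6 statements merged into one kernel-verified Lean document; each statement's English description precedes it below -/
import Mathlib

section
/- Let D be a category and A a class of morphisms of D such that for every f ∈ A and every morphism of D with the same codomain, a pullback of f along it exists, and every such pullback of f again lies in A. Let p : C ⟶ D be an admissibility fibration relative to A. Then for every strongly p-cartesian morphism a : y ⟶ x of C with p(a) ∈ A and every morphism b : w ⟶ x of C, there exist an object z of C and morphisms a′ : z ⟶ w, b′ : z ⟶ y forming a pullback square a ∘ b′ = b ∘ a′ in C, such that a′ is strongly p-cartesian and p(a′) ∈ A. In other words, base changes of admissible morphisms of C along arbitrary morphisms of C exist and are themselves admissible. (Part (3) of the admissibility-structure axioms verified in Proposition 4.1.9.) -/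
open CategoryTheory

universe v₁ v₂ u₁ u₂

/-- A morphism `a : x ⟶ y` in `C` is *strongly `p`-cartesian* for a functor `p : C ⥤ D`
if for every `ψ : r ⟶ y` and every `g : p(r) ⟶ p(x)` with `p(a) ∘ g = p(ψ)` there is a
unique `χ : r ⟶ x` with `p(χ) = g` and `a ∘ χ = ψ`. -/
def StronglyCartesian {C : Type u₁} {D : Type u₂} [Category.{v₁} C] [Category.{v₂} D]
    (p : C ⥤ D) {x y : C} (a : x ⟶ y) : Prop :=
  ∀ ⦃r : C⦄ (ψ : r ⟶ y) (g : p.obj r ⟶ p.obj x),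
    g ≫ p.map a = p.map ψ → ∃! χ : r ⟶ x, p.map χ = g ∧ χ ≫ a = ψ

/-- A functor `p : C ⥤ D` into a category with a distinguished class of morphisms `A` is an
*admissibility fibration* if for every object `y` of `C` and every morphism `b : z ⟶ p(y)`
belonging to `A` there is a strongly `p`-cartesian morphism `a` with codomain `y` and
`p(a) = b` (up to the canonical identification of objects). -/
def AdmissibilityFibration {C : Type u₁} {D : Type u₂} [Category.{v₁} C] [Category.{v₂} D]
    (p : C ⥤ D) (A : MorphismProperty D) : Prop :=
  ∀ (y : C) ⦃z : D⦄ (b : z ⟶ p.obj y), A b →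
    ∃ (x : C) (a : x ⟶ y) (h : p.obj x = z),
      StronglyCartesian p a ∧ p.map a = eqToHom h ≫ b

namespace StronglyCartesian

variable {C : Type u₁} {D : Type u₂} [Category.{v₁} C] [Category.{v₂} D] {p : C ⥤ D}

theorem hom_ext {x y r : C} {a : x ⟶ y} (ha : StronglyCartesian p a) {χ χ' : r ⟶ x}
    (hp : p.map χ = p.map χ') (h : χ ≫ a = χ' ≫ a) : χ = χ' :=
  (ha (χ' ≫ a) (p.map χ') (p.map_comp _ _).symm).unique ⟨hp, h⟩ ⟨rfl, rfl⟩

/-- A commutative square with two opposite strongly cartesian sides is a pullback as soon as its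
image is. -/
theorem isPullback_of_map {x y z w : C} {a : y ⟶ x} {b : w ⟶ x} {a' : z ⟶ w} {b' : z ⟶ y}
    (ha : StronglyCartesian p a) (ha' : StronglyCartesian p a') (comm : b' ≫ a = a' ≫ b)
    (h : IsPullback (p.map b') (p.map a') (p.map a) (p.map b)) : IsPullback b' a' a b := by
  have exists_lift (s : Limits.PullbackCone a b) :
      ∃ χ : s.pt ⟶ z, χ ≫ b' = s.fst ∧ χ ≫ a' = s.snd := by
    have hs : p.map s.fst ≫ p.map a = p.map s.snd ≫ p.map b := by
      rw [← p.map_comp, ← p.map_comp, s.condition]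
    obtain ⟨χ, ⟨hp, hχ⟩, -⟩ := ha' s.snd (h.lift _ _ hs) (h.lift_snd _ _ hs)
    refine ⟨χ, ha.hom_ext ?_ ?_, hχ⟩
    · rw [p.map_comp, hp, h.lift_fst]
    · rw [Category.assoc, comm, reassoc_of% hχ, s.condition]
  choose lift lift_fst lift_snd using exists_lift
  refine ⟨⟨comm⟩, ⟨Limits.PullbackCone.IsLimit.mk comm lift lift_fst lift_snd
    fun s m hm_fst hm_snd => ha'.hom_ext (h.hom_ext ?_ ?_) (hm_snd.trans (lift_snd s).symm)⟩⟩
  · rw [← p.map_comp, ← p.map_comp, hm_fst, lift_fst]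
  · rw [← p.map_comp, ← p.map_comp, hm_snd, lift_snd]

end StronglyCartesian

/-- Base changes of admissible morphisms of `C` along arbitrary morphisms of `C` exist and
are themselves admissible. -/
theorem statement2 {C : Type u₁} {D : Type u₂} [Category.{v₁} C] [Category.{v₂} D]
    (p : C ⥤ D) (A : MorphismProperty D)
    (hA_exists : ∀ ⦃X Y Z : D⦄ (f : Y ⟶ Z) (g : X ⟶ Z), A f →
      ∃ (W : D) (f' : W ⟶ X) (g' : W ⟶ Y), IsPullback g' f' f g)
    (hA_stable : ∀ ⦃X Y Z W : D⦄ (f : Y ⟶ Z) (g : X ⟶ Z) (f' : W ⟶ X) (g' : W ⟶ Y),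
      IsPullback g' f' f g → A f → A f')
    (hfib : AdmissibilityFibration p A)
    {x y : C} (a : y ⟶ x) (ha : StronglyCartesian p a) (haA : A (p.map a))
    {w : C} (b : w ⟶ x) :
    ∃ (z : C) (a' : z ⟶ w) (b' : z ⟶ y),
      IsPullback b' a' a b ∧ StronglyCartesian p a' ∧ A (p.map a') := by
  obtain ⟨W, f', g', hpb⟩ := hA_exists (p.map a) (p.map b) haA
  have hf' : A f' := hA_stable _ _ _ _ hpb haA
  obtain ⟨z, a', rfl, ha', hpa'⟩ := hfib w f' hf'
  obtain rfl : p.map a' = f' := by simpa using hpa'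
  obtain ⟨b', ⟨rfl, comm⟩, -⟩ := ha (a' ≫ b) g' (by rw [p.map_comp, hpb.w])
  exact ⟨z, a', b', ha.isPullback_of_map ha' comm hpb, ha', hf'⟩
end

section
/- Let D be a site whose covering families consist of morphisms belonging to an admissibility structure A on D, and let p : C ⟶ D be an admissibility fibration relative to A. Declare a family {a_i : x_i ⟶ x}_{i∈I} of morphisms of C to be covering if every a_i is strongly p-cartesian and {p(a_i) : p(x_i) ⟶ p(x)} is a covering family in D. Then these covering families form a coverage on C: for every covering family {a_i : x_i ⟶ x}_{i∈I} and every morphism b : w ⟶ x of C, there exist a covering family {c_j : v_j ⟶ w}_{j∈J} of w, a function h : J ⟶ I, and morphisms y_j : v_j ⟶ x_{h(j)} such that b ∘ c_j = a_{h(j)} ∘ y_j for every j ∈ J. (The coverage part of Proposition 4.1.9.) -/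
open CategoryTheory

universe uw v₁ v₂ u₁ u₂

/-- `X` is a retract of `Y`. -/
def IsRetractOf {E : Type u₁} [Category.{v₁} E] (X Y : E) : Prop :=
  ∃ (i : X ⟶ Y) (r : Y ⟶ X), i ≫ r = 𝟙 X

/-- An *admissibility structure* on `D`: a class of morphisms containing all identities,
closed under retracts in the arrow category, satisfying right cancellation, and closed under
base change (which exists). -/
structure IsAdmissibilityStructure {D : Type u₂} [Category.{v₂} D]
    (A : MorphismProperty D) : Prop where
  id_mem : ∀ x : D, A (𝟙 x)
  retracts : ∀ ⦃w x y z : D⦄ (f : w ⟶ x) (g : y ⟶ z),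
    IsRetractOf (Arrow.mk f) (Arrow.mk g) → A g → A f
  cancel : ∀ ⦃x y z : D⦄ (f : x ⟶ y) (g : y ⟶ z), A g → A (f ≫ g) → A f
  pullback_exists : ∀ ⦃X Y Z : D⦄ (f : Y ⟶ Z) (g : X ⟶ Z), A f →
    ∃ (W : D) (f' : W ⟶ X) (g' : W ⟶ Y), IsPullback g' f' f g
  pullback_mem : ∀ ⦃X Y Z W : D⦄ (f : Y ⟶ Z) (g : X ⟶ Z) (f' : W ⟶ X) (g' : W ⟶ Y),
    IsPullback g' f' f g → A f → A f'

/-- An indexed family of morphisms with common codomain `x`. -/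
structure CoveringFamily {E : Type u₁} [Category.{v₁} E] (x : E) : Type (max u₁ v₁ (uw + 1)) where
  ι : Type uw
  obj : ι → E
  hom : ∀ i, obj i ⟶ x

/-- The image of a family of morphisms under a functor. -/
def CoveringFamily.map {C : Type u₁} {D : Type u₂} [Category.{v₁} C] [Category.{v₂} D]
    (p : C ⥤ D) {x : C} (S : CoveringFamily.{uw} x) : CoveringFamily.{uw} (p.obj x) where
  ι := S.ι
  obj i := p.obj (S.obj i)
  hom i := p.map (S.hom i)

/-- Two families with pointwise equal objects, and homs equal up to transport, are equal. -/
theorem CoveringFamily.mk_eq_of_eqToHom {E : Type u₁} [Category.{v₁} E] {x : E} {ι : Type uw}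
    {obj obj' : ι → E} (hobj : obj = obj') (hom : ∀ i, obj i ⟶ x) (hom' : ∀ i, obj' i ⟶ x)
    (hhom : ∀ i, hom i = eqToHom (congrFun hobj i) ≫ hom' i) :
    (⟨ι, obj, hom⟩ : CoveringFamily.{uw} x) = ⟨ι, obj', hom'⟩ := by
  subst hobj
  have : hom = hom' := funext fun i => by simpa using hhom i
  rw [this]

/-- The coverage part of Proposition 4.1.9: if `D` is a site whose covering families consist
of morphisms of an admissibility structure `A` and `p : C ⥤ D` is an admissibility fibration,
then the families of strongly `p`-cartesian morphisms whose `p`-image is a covering family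
in `D` form a coverage on `C`. -/
theorem statement3 {C : Type u₁} {D : Type u₂} [Category.{v₁} C] [Category.{v₂} D]
    (A : MorphismProperty D) (hA : IsAdmissibilityStructure A)
    (covD : ∀ x : D, Set (CoveringFamily.{uw} x))
    (hcov_adm : ∀ (x : D) (S : CoveringFamily.{uw} x), S ∈ covD x → ∀ i, A (S.hom i))
    (hcoverage : ∀ (x : D) (S : CoveringFamily.{uw} x), S ∈ covD x → ∀ ⦃v : D⦄ (b₀ : v ⟶ x),
      ∃ T ∈ covD v, ∃ h : T.ι → S.ι, ∀ j, ∃ y : T.obj j ⟶ S.obj (h j),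
        T.hom j ≫ b₀ = y ≫ S.hom (h j))
    (p : C ⥤ D) (hfib : AdmissibilityFibration p A)
    (x : C) (S : CoveringFamily.{uw} x)
    (hS₁ : ∀ i, StronglyCartesian p (S.hom i))
    (hS₂ : S.map p ∈ covD (p.obj x))
    {w : C} (b : w ⟶ x) :
    ∃ T : CoveringFamily.{uw} w,
      (∀ j, StronglyCartesian p (T.hom j)) ∧ T.map p ∈ covD (p.obj w) ∧
        ∃ h : T.ι → S.ι, ∀ j, ∃ y : T.obj j ⟶ S.obj (h j),
          T.hom j ≫ b = y ≫ S.hom (h j) := by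
  obtain ⟨U, hU, h, hy⟩ := hcoverage (p.obj x) (S.map p) hS₂ (p.map b)
  choose v c hv hc hpc using fun j => hfib w (U.hom j) (hcov_adm _ U hU j)
  refine ⟨⟨U.ι, v, c⟩, hc, ?_, h, fun j => ?_⟩
  · have hmap := CoveringFamily.mk_eq_of_eqToHom (funext hv)
      (fun j => p.map (c j)) U.hom hpc
    change (⟨U.ι, fun j => p.obj (v j), fun j => p.map (c j)⟩ :
      CoveringFamily.{uw} (p.obj w)) ∈ covD (p.obj w)
    rwa [hmap]
  · obtain ⟨y, hy⟩ := hy j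
    have hlift : (eqToHom (hv j) ≫ y) ≫ p.map (S.hom (h j)) = p.map (c j ≫ b) := by
      rw [p.map_comp, hpc]
      exact (Category.assoc _ _ _).trans
        ((congrArg (eqToHom (hv j) ≫ ·) hy.symm).trans (Category.assoc _ _ _).symm)
    obtain ⟨χ, ⟨-, hχ⟩, -⟩ := hS₁ (h j) (c j ≫ b) (eqToHom (hv j) ≫ y) hlift
    exact ⟨χ, hχ.symm⟩
end

section
/- Let p : C ⟶ D be an admissibility fibration relative to an admissibility structure A on D in which every morphism belonging to A is a monomorphism. Call a subobject of an object of C admissible if it can be represented by a morphism that is strongly p-cartesian with p-image in A, and call a subobject of an object of D admissible if it can be represented by a morphism in A. Then for every object c of C, the assignment sending the class of an admissible monomorphism r into c to the class of p(r) is a well-defined order isomorphism from the poset of admissible subobjects of c onto the poset of admissible subobjects of p(c). (Proposition 4.1.11.) -/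
open CategoryTheory

universe v₁ v₂ u₁ u₂

/-- A subobject of `c ∈ C` is *admissible* if it can be represented by a monomorphism that
is strongly `p`-cartesian with `p`-image in `A`. -/
def AdmissibleSubobjectC {C : Type u₁} {D : Type u₂} [Category.{v₁} C] [Category.{v₂} D]
    (p : C ⥤ D) (A : MorphismProperty D) (c : C) (S : Subobject c) : Prop :=
  ∃ (x : C) (r : x ⟶ c) (hr : Mono r),
    StronglyCartesian p r ∧ A (p.map r) ∧ @Subobject.mk _ _ _ _ r hr = S

/-- A subobject of `d ∈ D` is *admissible* if it can be represented by a morphism in `A`. -/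
def AdmissibleSubobjectD {D : Type u₂} [Category.{v₂} D]
    (A : MorphismProperty D) (d : D) (S : Subobject d) : Prop :=
  ∃ (y : D) (r : y ⟶ d) (hr : Mono r), A r ∧ @Subobject.mk _ _ _ _ r hr = S

/-- A strongly cartesian morphism with monic image is monic. -/
theorem StronglyCartesian.mono {C : Type u₁} {D : Type u₂} [Category.{v₁} C]
    [Category.{v₂} D] {p : C ⥤ D} {x y : C} {a : x ⟶ y} (ha : StronglyCartesian p a)
    [Mono (p.map a)] : Mono a where
  right_cancellation {w} f g hfg := by
    have hp : p.map f = p.map g := by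
      rw [← cancel_mono (p.map a), ← p.map_comp, ← p.map_comp, hfg]
    exact (ha (g ≫ a) (p.map g) (p.map_comp g a).symm).unique ⟨hp, hfg⟩ ⟨rfl, rfl⟩

/-- A functor preserves and reflects the order between subobjects when the larger one is represented by a
strongly cartesian morphism. -/
theorem StronglyCartesian.mk_map_le_mk_map_iff {C : Type u₁} {D : Type u₂} [Category.{v₁} C]
    [Category.{v₂} D] {p : C ⥤ D} {x y c : C} {r : x ⟶ c} {s : y ⟶ c} [Mono r] [Mono s]
    [Mono (p.map r)] [Mono (p.map s)] (hs : StronglyCartesian p s) :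
    Subobject.mk (p.map r) ≤ Subobject.mk (p.map s) ↔ Subobject.mk r ≤ Subobject.mk s := by
  constructor
  · intro h
    obtain ⟨χ, ⟨-, hχ⟩, -⟩ := hs r (Subobject.ofMkLEMk _ _ h) (Subobject.ofMkLEMk_comp h)
    exact Subobject.mk_le_mk_of_comm χ hχ
  · intro h
    refine Subobject.mk_le_mk_of_comm (p.map (Subobject.ofMkLEMk _ _ h)) ?_
    rw [← p.map_comp, Subobject.ofMkLEMk_comp]

/-- Proposition 4.1.11: for an admissibility fibration `p` over an admissibility structure
`A` whose members are monomorphisms, sending the class of an admissible monomorphism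
`r` into `c` to the class of `p(r)` is a well-defined order isomorphism from the poset of
admissible subobjects of `c` onto the poset of admissible subobjects of `p(c)`. -/
theorem statement4 {C : Type u₁} {D : Type u₂} [Category.{v₁} C] [Category.{v₂} D]
    (p : C ⥤ D) (A : MorphismProperty D) (hA : IsAdmissibilityStructure A)
    (hmono : ∀ ⦃x y : D⦄ (f : x ⟶ y), A f → Mono f)
    (hfib : AdmissibilityFibration p A) (c : C) :
    ∃ e : {S : Subobject c // AdmissibleSubobjectC p A c S} ≃o
        {S : Subobject (p.obj c) // AdmissibleSubobjectD A (p.obj c) S},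
      ∀ (x : C) (r : x ⟶ c) (hr : Mono r)
        (hcart : StronglyCartesian p r) (hAr : A (p.map r)),
        e ⟨@Subobject.mk _ _ _ _ r hr, x, r, hr, hcart, hAr, rfl⟩ =
          ⟨@Subobject.mk _ _ _ _ (p.map r) (hmono _ hAr),
            p.obj x, p.map r, hmono _ hAr, hAr, rfl⟩ := by
  choose X ρ hρ hcartρ hAρ hmkρ using
    fun S : {S : Subobject c // AdmissibleSubobjectC p A c S} => S.2
  have hpρ : ∀ S, Mono (p.map (ρ S)) := fun S => hmono _ (hAρ S)
  let φ : {S : Subobject c // AdmissibleSubobjectC p A c S} ↪o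
      {S : Subobject (p.obj c) // AdmissibleSubobjectD A (p.obj c) S} :=
    OrderEmbedding.ofMapLEIff
      (fun S => ⟨Subobject.mk (p.map (ρ S)), _, p.map (ρ S), hpρ S, hAρ S, rfl⟩)
      (fun S T => (hcartρ T).mk_map_le_mk_map_iff.trans (by rw [hmkρ, hmkρ]; rfl))
  have hφ : ∀ (x : C) (r : x ⟶ c) (hr : Mono r)
      (hcart : StronglyCartesian p r) (hAr : A (p.map r)),
      φ ⟨@Subobject.mk _ _ _ _ r hr, x, r, hr, hcart, hAr, rfl⟩ =
        ⟨@Subobject.mk _ _ _ _ (p.map r) (hmono _ hAr),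
          p.obj x, p.map r, hmono _ hAr, hAr, rfl⟩ := by
    intro x r hr hcart hAr
    have hpr := hmono _ hAr
    let S : {S : Subobject c // AdmissibleSubobjectC p A c S} :=
      ⟨Subobject.mk r, x, r, hr, hcart, hAr, rfl⟩
    apply Subtype.ext
    change Subobject.mk (p.map (ρ S)) = Subobject.mk (p.map r)
    exact le_antisymm (hcart.mk_map_le_mk_map_iff.2 (hmkρ S).le)
      ((hcartρ S).mk_map_le_mk_map_iff.2 (hmkρ S).ge)
  refine ⟨RelIso.ofSurjective φ ?_, hφ⟩
  rintro ⟨_, z, b, hb, hAb, rfl⟩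
  obtain ⟨x, a, rfl, hcart, hpa⟩ := hfib c b hAb
  obtain rfl : p.map a = b := by simpa using hpa
  exact ⟨_, hφ x a hcart.mono hcart hAb⟩
end

section
/- Let p : C ⟶ D, p′ : C′ ⟶ D′, F : C ⟶ C′, and G : D ⟶ D′ be functors with p′ ∘ F = G ∘ p. Let φ : a ⟶ b be a morphism of C such that φ is strongly p-cartesian, F(φ) is strongly p′-cartesian, and p(φ) is strongly G-cartesian. Then φ is strongly F-cartesian: for every morphism ψ : r ⟶ b in C and every γ : F(r) ⟶ F(a) in C′ with F(φ) ∘ γ = F(ψ), there exists a unique χ : r ⟶ a with φ ∘ χ = ψ and F(χ) = γ. (The key step in the proof of Proposition 4.2.6, showing that the base functor of a fibered geometric site reflects admissible arrows.) -/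
open CategoryTheory

universe v₁ v₂ v₃ v₄ u₁ u₂ u₃ u₄

/-- In a square of functors commuting up to natural isomorphism, a strongly `p`-cartesian `φ` with
`F(φ)` strongly `p′`-cartesian and `p(φ)` strongly `G`-cartesian is strongly `F`-cartesian. -/
theorem StronglyCartesian.of_square_iso {C : Type u₁} {D : Type u₂} {C' : Type u₃} {D' : Type u₄}
    [Category.{v₁} C] [Category.{v₂} D] [Category.{v₃} C'] [Category.{v₄} D']
    {p : C ⥤ D} {p' : C' ⥤ D'} {F : C ⥤ C'} {G : D ⥤ D'} (e : F ⋙ p' ≅ p ⋙ G)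
    {a b : C} {φ : a ⟶ b} (h₁ : StronglyCartesian p φ)
    (h₂ : StronglyCartesian p' (F.map φ)) (h₃ : StronglyCartesian G (p.map φ)) :
    StronglyCartesian F φ := by
  intro r ψ γ hγ
  have map_map {x y : C} (f : x ⟶ y) :
      G.map (p.map f) = e.inv.app x ≫ p'.map (F.map f) ≫ e.hom.app y :=
    (NatIso.naturality_1 e f).symm
  have hφ : (e.inv.app r ≫ p'.map γ ≫ e.hom.app a) ≫ G.map (p.map φ) = G.map (p.map ψ) := by
    simp [map_map, ← hγ]
  obtain ⟨δ, ⟨hδ, hδφ⟩, δ_uniq⟩ := h₃ (p.map ψ) _ hφ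
  obtain ⟨χ, ⟨hχ, hχφ⟩, χ_uniq⟩ := h₁ ψ δ hδφ
  have hp' : p'.map (F.map χ) = p'.map γ := by
    rw [← hχ, map_map] at hδ
    exact (cancel_mono (e.hom.app a)).1 ((cancel_epi (e.inv.app r)).1 hδ)
  refine ⟨χ, ⟨?_, hχφ⟩, ?_⟩
  · exact (h₂ (F.map ψ) (p'.map γ) (by rw [← p'.map_comp, hγ])).unique
      ⟨hp', by rw [← F.map_comp, hχφ]⟩ ⟨rfl, hγ⟩
  · rintro χ' ⟨hχ', hχ'φ⟩
    refine χ_uniq χ' ⟨δ_uniq _ ⟨?_, ?_⟩, hχ'φ⟩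
    · rw [map_map, hχ']
    · rw [← p.map_comp, hχ'φ]

/-- Given functors `p : C ⥤ D`, `p′ : C′ ⥤ D′`, `F : C ⥤ C′`, `G : D ⥤ D′` with
`p′ ∘ F = G ∘ p`, if `φ` is strongly `p`-cartesian, `F(φ)` is strongly `p′`-cartesian and
`p(φ)` is strongly `G`-cartesian, then `φ` is strongly `F`-cartesian. -/
theorem statement6 {C : Type u₁} {D : Type u₂} {C' : Type u₃} {D' : Type u₄}
    [Category.{v₁} C] [Category.{v₂} D] [Category.{v₃} C'] [Category.{v₄} D']
    (p : C ⥤ D) (p' : C' ⥤ D') (F : C ⥤ C') (G : D ⥤ D')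
    (hcomm : F ⋙ p' = p ⋙ G)
    {a b : C} (φ : a ⟶ b)
    (h₁ : StronglyCartesian p φ)
    (h₂ : StronglyCartesian p' (F.map φ))
    (h₃ : StronglyCartesian G (p.map φ)) :
    StronglyCartesian F φ :=
  .of_square_iso (eqToIso hcomm) h₁ h₂ h₃
end

section
/- Let C be a thin category (a preorder: there is at most one morphism between any two objects) that admits pullbacks. Then every functor from a finite connected category to C admits a cone; i.e., C is weakly cofiltered. (The step in the proof of Proposition 6.2.4 asserting that a preorder with pullbacks is weakly cofiltered, which feeds into Proposition 6.2.3.) -/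
open CategoryTheory

universe v u

/-- In a category with pullbacks, admitting a common source is a transitive relation. -/
theorem exists_common_source_trans {C : Type u} [Category.{v} C] [Limits.HasPullbacks C]
    {X Y Z : C} (hXY : ∃ W : C, Nonempty (W ⟶ X) ∧ Nonempty (W ⟶ Y))
    (hYZ : ∃ W : C, Nonempty (W ⟶ Y) ∧ Nonempty (W ⟶ Z)) :
    ∃ W : C, Nonempty (W ⟶ X) ∧ Nonempty (W ⟶ Z) := by
  obtain ⟨A, ⟨a⟩, ⟨f⟩⟩ := hXY
  obtain ⟨B, ⟨g⟩, ⟨b⟩⟩ := hYZ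
  exact ⟨Limits.pullback f g, ⟨Limits.pullback.fst f g ≫ a⟩, ⟨Limits.pullback.snd f g ≫ b⟩⟩

/-- In a category with pullbacks, any two values of a functor from a preconnected category
admit a common source. -/
theorem exists_common_source_obj {C : Type u} [Category.{v} C] [Limits.HasPullbacks C]
    {J : Type*} [Category J] [IsPreconnected J] (G : J ⥤ C) (i j : J) :
    ∃ W : C, Nonempty (W ⟶ G.obj i) ∧ Nonempty (W ⟶ G.obj j) := by
  refine equiv_relation
    (fun i j => ∃ W : C, Nonempty (W ⟶ G.obj i) ∧ Nonempty (W ⟶ G.obj j))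
    ⟨fun i => ⟨G.obj i, ⟨𝟙 _⟩, ⟨𝟙 _⟩⟩, fun ⟨W, hi, hj⟩ => ⟨W, hj, hi⟩,
      exists_common_source_trans⟩
    (fun {i _} f => ⟨G.obj i, ⟨𝟙 _⟩, ⟨G.map f⟩⟩) i j

/-- In a category with pullbacks, any finite family of values of a functor from a preconnected
category admits a common source, which moreover maps to any prescribed further value. -/
theorem exists_common_source_finset {C : Type u} [Category.{v} C] [Limits.HasPullbacks C]
    {J : Type*} [Category J] [IsPreconnected J] (G : J ⥤ C) (i : J) (s : Finset J) :
    ∃ W : C, Nonempty (W ⟶ G.obj i) ∧ ∀ j ∈ s, Nonempty (W ⟶ G.obj j) := by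
  classical
  induction s using Finset.induction_on with
  | empty => exact ⟨G.obj i, ⟨𝟙 _⟩, by simp⟩
  | insert k s _ ih =>
    obtain ⟨A, ⟨f⟩, hA⟩ := ih
    obtain ⟨B, ⟨g⟩, ⟨b⟩⟩ := exists_common_source_obj G i k
    refine ⟨Limits.pullback f g, ⟨Limits.pullback.fst f g ≫ f⟩, fun j hj => ?_⟩
    rcases Finset.mem_insert.mp hj with rfl | hj
    · exact ⟨Limits.pullback.snd f g ≫ b⟩
    · exact (hA j hj).map (Limits.pullback.fst f g ≫ ·)

/-- A thin category (preorder) with pullbacks is weakly cofiltered: every functor from a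
finite connected category admits a cone. -/
theorem statement12 {C : Type u} [Category.{v} C] (hthin : Quiver.IsThin C)
    [Limits.HasPullbacks C] :
    ∀ (J : Type) [SmallCategory J] [FinCategory J] [IsConnected J] (G : J ⥤ C),
      Nonempty (Limits.Cone G) := by
  intro J _ _ _ G
  obtain ⟨i⟩ : Nonempty J := IsConnected.is_nonempty
  obtain ⟨W, -, hW⟩ := exists_common_source_finset G i Finset.univ
  exact ⟨{ pt := W
           π := { app := fun j => (hW j (Finset.mem_univ j)).some
                  naturality := fun _ _ _ => (hthin _ _).elim _ _ } }⟩
end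

section
/- Let h : ℝ² ⟶ ℝ² be a map that is differentiable at (0,0) and suppose that the first coordinate of h vanishes at every point of the line {(x,y) : x = 0} and the second coordinate of h vanishes at every point of the parabola {(x,y) : x = y²}. Then the derivative of h at (0,0) sends the vector (0,1) to 0; in particular, the derivative of h at (0,0) is not surjective, so (0,0) is not a regular point of h even though h(0,0) = (0,0). Consequently, there is no smooth map h : ℝ² ⟶ ℝ² having (0,0) as a regular value such that the zero set of its first coordinate is the line x = 0 and the zero set of its second coordinate is the parabola x = y². (The claim proved in Example 5.2.6: two cuts that intersect tangentially cannot form a cut grid.) -/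
/-- If `f` vanishes along a curve, its derivative kills the velocity vector of the curve. -/
theorem HasFDerivAt.apply_eq_zero_of_comp_eq_zero {E F : Type*} [NormedAddCommGroup E]
    [NormedSpace ℝ E] [NormedAddCommGroup F] [NormedSpace ℝ F] {f : E → F} {L : E →L[ℝ] F}
    {γ : ℝ → E} {v : E} {t : ℝ} (hf : HasFDerivAt f L (γ t)) (hγ : HasDerivAt γ v t)
    (h : ∀ s, f (γ s) = 0) : L v = 0 := by
  have hcomp : HasDerivAt (f ∘ γ) (L v) t := hf.comp_hasDerivAt t hγ
  have hzero : f ∘ γ = fun _ => 0 := funext h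
  rw [hzero] at hcomp
  exact hcomp.unique (hasDerivAt_const t 0)

/-- If the first coordinate of `h` vanishes on the line `x = 0` and the second one on the
parabola `x = y²`, the derivative of `h` at the origin kills `(0, 1)`. -/
theorem fderiv_apply_eq_zero_of_tangent_cuts {h : ℝ × ℝ → ℝ × ℝ}
    (hd : DifferentiableAt ℝ h (0, 0)) (h₁ : ∀ y : ℝ, (h (0, y)).1 = 0)
    (h₂ : ∀ y : ℝ, (h (y ^ 2, y)).2 = 0) : fderiv ℝ h (0, 0) (0, 1) = 0 := by
  have hline : HasDerivAt (fun y : ℝ => ((0 : ℝ), y)) (0, 1) 0 :=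
    (hasDerivAt_const _ _).prodMk (hasDerivAt_id _)
  have hparabola : HasDerivAt (fun y : ℝ => (y ^ 2, y)) (0, 1) 0 := by
    have hsq : HasDerivAt (fun y : ℝ => y ^ 2) 0 0 := by simpa using hasDerivAt_pow 2 (0 : ℝ)
    exact hsq.prodMk (hasDerivAt_id _)
  have hd' : HasFDerivAt h (fderiv ℝ h (0, 0)) ((0 : ℝ) ^ 2, (0 : ℝ)) := by
    simpa using hd.hasFDerivAt
  exact Prod.ext (hd.hasFDerivAt.fst.apply_eq_zero_of_comp_eq_zero hline h₁)
    (HasFDerivAt.apply_eq_zero_of_comp_eq_zero (γ := fun y : ℝ => (y ^ 2, y)) hd'.snd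
      hparabola h₂)

/-- A linear endomorphism of the plane that kills `(0, 1)` is not surjective. -/
theorem not_surjective_of_apply_eq_zero {L : ℝ × ℝ →L[ℝ] ℝ × ℝ} (hL : L (0, 1) = 0) :
    ¬ Function.Surjective L := by
  intro hs
  have hinj : Function.Injective (L : ℝ × ℝ →ₗ[ℝ] ℝ × ℝ) :=
    LinearMap.injective_iff_surjective.mpr hs
  have h01 : ((0 : ℝ), (1 : ℝ)) = 0 := hinj (by simpa using hL)
  simp at h01

/-- Two cuts that intersect tangentially cannot form a cut grid.
First part: if `h : ℝ² → ℝ²` is differentiable at `(0,0)`, its first coordinate vanishes on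
the line `x = 0` and its second coordinate vanishes on the parabola `x = y²`, then the
derivative of `h` at `(0,0)` kills the vector `(0,1)`, so it is not surjective.
Second part: consequently there is no smooth `h : ℝ² → ℝ²` having `(0,0)` as a regular
value whose first coordinate has zero set the line `x = 0` and whose second coordinate has
zero set the parabola `x = y²`. -/
theorem statement13 :
    (∀ h : ℝ × ℝ → ℝ × ℝ, DifferentiableAt ℝ h (0, 0) →
      (∀ y : ℝ, (h (0, y)).1 = 0) →
      (∀ y : ℝ, (h (y ^ 2, y)).2 = 0) →
      fderiv ℝ h (0, 0) (0, 1) = 0 ∧ ¬ Function.Surjective (fderiv ℝ h (0, 0))) ∧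
    ¬ ∃ h : ℝ × ℝ → ℝ × ℝ, ContDiff ℝ (⊤ : ℕ∞) h ∧
        (∀ q : ℝ × ℝ, h q = (0, 0) → Function.Surjective (fderiv ℝ h q)) ∧
        {q : ℝ × ℝ | (h q).1 = 0} = {q : ℝ × ℝ | q.1 = 0} ∧
        {q : ℝ × ℝ | (h q).2 = 0} = {q : ℝ × ℝ | q.1 = q.2 ^ 2} := by
  have key : ∀ h : ℝ × ℝ → ℝ × ℝ, DifferentiableAt ℝ h (0, 0) →
      (∀ y : ℝ, (h (0, y)).1 = 0) → (∀ y : ℝ, (h (y ^ 2, y)).2 = 0) →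
      fderiv ℝ h (0, 0) (0, 1) = 0 ∧ ¬ Function.Surjective (fderiv ℝ h (0, 0)) := by
    intro h hd h₁ h₂
    have hzero := fderiv_apply_eq_zero_of_tangent_cuts hd h₁ h₂
    exact ⟨hzero, not_surjective_of_apply_eq_zero hzero⟩
  refine ⟨key, ?_⟩
  rintro ⟨h, hsmooth, hreg, hfst, hsnd⟩
  have h₁ : ∀ y : ℝ, (h (0, y)).1 = 0 := fun y => (Set.ext_iff.mp hfst (0, y)).mpr rfl
  have h₂ : ∀ y : ℝ, (h (y ^ 2, y)).2 = 0 := fun y => (Set.ext_iff.mp hsnd (y ^ 2, y)).mpr rfl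
  have h₀ : h (0, 0) = (0, 0) := Prod.ext (h₁ 0) (by simpa using h₂ 0)
  have hd : DifferentiableAt ℝ h (0, 0) := (hsmooth.differentiable (by simp)).differentiableAt
  exact (key h hd h₁ h₂).2 (hreg _ h₀)
end
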